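/- For all integers j, b, c, m, s, δ with j > 0, b > 0, c > 0, m > 1, s > 1, and δ = 1 or δ = -1, the equation (j+1)*s*((j+m)*(b+c) + b) = (j+1)^2*(b+c)*s + (j+m)*(b+c) + b + δ has no solution; that is, the two sides are never equal. -/

import Mathlib

theorem stmt_2 (j b c m s δ : ℤ)
    (hj : j > 0) (hb : b > 0) (hc : c > 0) (hm : m > 1) (hs : s > 1)
    (hδ : δ = 1 ∨ δ = -1) :
    (j + 1) * s * ((j + m) * (b + c) + b) ≠
      (j + 1) ^ 2 * (b + c) * s + (j + m) * (b + c) + b + δ := by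
  intro h
  have key : (b + c) * ((m - 1) * ((j + 1) * s) - (j + m)) + b * ((j + 1) * s - 1) = δ := by
    linear_combination h
  have hjs : 2 * (j + 1) ≤ (j + 1) * s := by nlinarith
  have hcoeff : 0 < (m - 1) * ((j + 1) * s) - (j + m) := by
    have h₁ : (m - 1) * (2 * (j + 1)) ≤ (m - 1) * ((j + 1) * s) :=
      mul_le_mul_of_nonneg_left hjs (by lia)
    have h₂ : 0 ≤ (m - 2) * j := mul_nonneg (by lia) (by lia)
    nlinarith
  have hfirst : 0 < (b + c) * ((m - 1) * ((j + 1) * s) - (j + m)) := mul_pos (by lia) hcoeff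
  have hsecond : 0 < b * ((j + 1) * s - 1) := mul_pos hb (by lia)
  lia
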